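/- Let Q₁ and Q₂ be unions of conjunctive queries with negation and inequalities (UCQ¬,≠). If there is an instance I with Q₁(I) ⊄ Q₂(I), then there is an instance J ⊆ I with Q₁(J) ⊄ Q₂(J) and |adom(J)| ≤ varmax(Q₁). -/

import Mathlib

/-- An atom `R(x₁,…,x_k)`: a relation name together with a tuple of variables. -/
structure Atom (R V : Type) where
  rel : R
  args : List V
deriving DecidableEq

/-- A fact `R(t)`: a relation name together with a tuple of data values. -/
structure DBFact (R D : Type) where
  rel : R
  args : List D
deriving DecidableEq

/-- Applying a valuation to an atom yields a fact. -/
def Atom.app {R V D : Type} (f : V → D) (a : Atom R V) : DBFact R D :=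
  ⟨a.rel, a.args.map f⟩

/-- The variables occurring in an atom. -/
def Atom.vars {R V : Type} (a : Atom R V) : Set V := {v | v ∈ a.args}

/-- A conjunctive query with negation and inequalities (CQ¬,≠): a head atom,
finite sets of positive and negated body atoms, and a finite set of
inequalities between variables. -/
structure CQ (R V : Type) where
  head : Atom R V
  pos : Finset (Atom R V)
  neg : Finset (Atom R V)
  ineq : Finset (V × V)

namespace CQ

variable {R V D : Type}

/-- The variables occurring in a query. -/
def vars (Q : CQ R V) : Set V :=
  Q.head.vars ∪ (⋃ a ∈ (↑Q.pos : Set (Atom R V)), a.vars) ∪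
    (⋃ a ∈ (↑Q.neg : Set (Atom R V)), a.vars) ∪
    (⋃ p ∈ (↑Q.ineq : Set (V × V)), {p.1, p.2})

/-- Safety: every head variable and every variable of a negated atom occurs in
some positive atom. -/
def safe (Q : CQ R V) : Prop :=
  (∀ v ∈ Q.head.vars, ∃ a ∈ Q.pos, v ∈ a.args) ∧
  (∀ a ∈ Q.neg, ∀ v ∈ a.args, ∃ b ∈ Q.pos, v ∈ b.args)

/-- A query is full if every one of its variables occurs in its head atom. -/
def isFull (Q : CQ R V) : Prop := ∀ v ∈ Q.vars, v ∈ Q.head.args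

/-- The facts required by a valuation `f`: `f(pos(Q))`. -/
def posFacts (Q : CQ R V) (f : V → D) : Set (DBFact R D) :=
  Atom.app f '' (↑Q.pos : Set (Atom R V))

/-- The facts prohibited by a valuation `f`: `f(neg(Q))`. -/
def negFacts (Q : CQ R V) (f : V → D) : Set (DBFact R D) :=
  Atom.app f '' (↑Q.neg : Set (Atom R V))

/-- `f` is a valuation for `Q`: required and prohibited facts are disjoint and
all inequalities are respected. -/
def isVal (Q : CQ R V) (f : V → D) : Prop :=
  Q.posFacts f ∩ Q.negFacts f = ∅ ∧
  ∀ p ∈ Q.ineq, f p.1 ≠ f p.2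

/-- `f` satisfies `Q` on `I`: all required facts are in `I` and no prohibited
fact is in `I`. -/
def sat (Q : CQ R V) (f : V → D) (I : Set (DBFact R D)) : Prop :=
  Q.posFacts f ⊆ I ∧ Q.negFacts f ∩ I = ∅

/-- `Q(I)`: the set of facts derived on `I` by valuations satisfying `Q`. -/
def eval (Q : CQ R V) (I : Set (DBFact R D)) : Set (DBFact R D) :=
  {fc | ∃ f : V → D, Q.isVal f ∧ Q.sat f I ∧ Atom.app f Q.head = fc}

end CQ

/-- A union of conjunctive queries (with negation and inequalities): a finite,
nonempty family of CQ¬,≠s. -/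
structure UCQ (R V : Type) where
  n : ℕ
  npos : 0 < n
  disj : Fin n → CQ R V

namespace UCQ

variable {R V D : Type}

/-- Well-formedness of a UCQ: every disjunct is safe, all disjuncts have the
same head relation, and distinct disjuncts have disjoint variable sets. -/
def wf (Q : UCQ R V) : Prop :=
  (∀ i, (Q.disj i).safe) ∧
  (∀ i j, (Q.disj i).head.rel = (Q.disj j).head.rel) ∧
  (∀ i j, i ≠ j → Disjoint (Q.disj i).vars (Q.disj j).vars)

/-- `Q(I) = ⋃ᵢ Qᵢ(I)`. -/
def eval (Q : UCQ R V) (I : Set (DBFact R D)) : Set (DBFact R D) :=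
  ⋃ i, (Q.disj i).eval I

/-- The maximum number of variables of any disjunct. -/
noncomputable def varmax (Q : UCQ R V) : ℕ :=
  Finset.univ.sup fun i => ((Q.disj i).vars).ncard

end UCQ

/-- The values of the fact all belong to `U`. -/
def DBFact.valsIn {R D : Type} (fc : DBFact R D) (U : Set D) : Prop :=
  ∀ d ∈ fc.args, d ∈ U

/-- The active domain of an instance: all data values occurring in it. -/
def adom {R D : Type} (I : Set (DBFact R D)) : Set D :=
  {d | ∃ fc ∈ I, d ∈ fc.args}

/-- The subinstance of `I` consisting of the facts all of whose values lie in `U`. -/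
def restrictVals {R D : Type} (I : Set (DBFact R D)) (U : Set D) : Set (DBFact R D) :=
  {fc ∈ I | fc.valsIn U}

theorem restrictVals_subset {R D : Type} (I : Set (DBFact R D)) (U : Set D) :
    restrictVals I U ⊆ I :=
  fun _ h => h.1

theorem adom_restrictVals_subset {R D : Type} (I : Set (DBFact R D)) (U : Set D) :
    adom (restrictVals I U) ⊆ U := by
  rintro d ⟨fc, hfc, hd⟩
  exact hfc.2 d hd

theorem Atom.app_valsIn_iff {R V D : Type} {f : V → D} {a : Atom R V} {U : Set D} :
    (Atom.app f a).valsIn U ↔ ∀ v ∈ a.args, f v ∈ U := by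
  simp [Atom.app, DBFact.valsIn]

namespace CQ

theorem vars_finite {R V : Type} (Q : CQ R V) : Q.vars.Finite := by
  have hatom (a : Atom R V) : a.vars.Finite := List.finite_toSet a.args
  unfold vars
  refine (((hatom _).union ?_).union ?_).union ?_
  · exact Q.pos.finite_toSet.biUnion fun a _ => hatom a
  · exact Q.neg.finite_toSet.biUnion fun a _ => hatom a
  · exact Q.ineq.finite_toSet.biUnion fun p _ => Set.toFinite _

theorem mem_vars_of_mem_pos {R V : Type} {Q : CQ R V} {a : Atom R V} {v : V}
    (ha : a ∈ Q.pos) (hv : v ∈ a.args) : v ∈ Q.vars :=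
  Or.inl (Or.inl (Or.inr (Set.mem_biUnion (Finset.mem_coe.2 ha) hv)))

theorem sat.restrictVals_image_vars {R V D : Type} {Q : CQ R V} {f : V → D}
    {I : Set (DBFact R D)} (h : Q.sat f I) : Q.sat f (restrictVals I (f '' Q.vars)) := by
  refine ⟨?_, Set.subset_empty_iff.1 (h.2 ▸ Set.inter_subset_inter_right _
    (restrictVals_subset _ _))⟩
  rintro _ ⟨a, ha, rfl⟩
  exact ⟨h.1 ⟨a, ha, rfl⟩, Atom.app_valsIn_iff.2 fun v hv =>
    Set.mem_image_of_mem f (mem_vars_of_mem_pos ha hv)⟩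

/-- By safety, a valuation satisfying a query on a value restriction of `I` satisfies it on `I`. -/
theorem sat.of_restrictVals {R V D : Type} {Q : CQ R V} (hQ : Q.safe) {f : V → D}
    {I : Set (DBFact R D)} {U : Set D} (h : Q.sat f (restrictVals I U)) : Q.sat f I := by
  refine ⟨h.1.trans (restrictVals_subset _ _), Set.eq_empty_iff_forall_notMem.2 ?_⟩
  rintro _ ⟨⟨a, ha, rfl⟩, hI⟩
  refine Set.eq_empty_iff_forall_notMem.1 h.2 _ ⟨⟨a, ha, rfl⟩, hI, Atom.app_valsIn_iff.2 ?_⟩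
  intro v hv
  obtain ⟨b, hb, hvb⟩ := hQ.2 a ha v hv
  exact Atom.app_valsIn_iff.1 (h.1 ⟨b, hb, rfl⟩).2 v hvb

end CQ

theorem UCQ.eval_restrictVals_subset {R V D : Type} {Q : UCQ R V} (hQ : Q.wf)
    (I : Set (DBFact R D)) (U : Set D) : Q.eval (restrictVals I U) ⊆ Q.eval I := by
  refine Set.iUnion_mono fun i => ?_
  rintro _ ⟨f, hval, hsat, rfl⟩
  exact ⟨f, hval, hsat.of_restrictVals (hQ.1 i), rfl⟩

theorem UCQ.ncard_vars_le_varmax {R V : Type} (Q : UCQ R V) (i : Fin Q.n) :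
    (Q.disj i).vars.ncard ≤ Q.varmax :=
  Finset.le_sup (f := fun i => (Q.disj i).vars.ncard) (Finset.mem_univ i)

/-- If `Q₁(I) ⊄ Q₂(I)` for some instance `I`, then there is an
instance `J ⊆ I` with `Q₁(J) ⊄ Q₂(J)` and `|adom(J)| ≤ varmax(Q₁)`. -/
theorem ucq_containment_small_counterexample {R V D : Type} [Infinite D]
    (Q1 Q2 : UCQ R V) (hQ1 : Q1.wf) (hQ2 : Q2.wf)
    (I : Set (DBFact R D)) (hI : I.Finite)
    (h : ¬ Q1.eval I ⊆ Q2.eval I) :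
    ∃ J ⊆ I, ¬ Q1.eval J ⊆ Q2.eval J ∧ (adom J).ncard ≤ Q1.varmax := by
  obtain ⟨fc, h1, h2⟩ := Set.not_subset.1 h
  obtain ⟨i, f, hval, hsat, hhead⟩ := Set.mem_iUnion.1 h1
  have hfin := (Q1.disj i).vars_finite
  refine ⟨restrictVals I (f '' (Q1.disj i).vars), restrictVals_subset _ _, ?_, ?_⟩
  · refine Set.not_subset.2 ⟨fc, ?_, fun hJ => h2 (UCQ.eval_restrictVals_subset hQ2 _ _ hJ)⟩
    exact Set.mem_iUnion.2 ⟨i, f, hval, hsat.restrictVals_image_vars, hhead⟩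
  · calc (adom (restrictVals I (f '' (Q1.disj i).vars))).ncard
        ≤ (f '' (Q1.disj i).vars).ncard :=
          Set.ncard_le_ncard (adom_restrictVals_subset _ _) (hfin.image f)
      _ ≤ (Q1.disj i).vars.ncard := Set.ncard_image_le hfin
      _ ≤ Q1.varmax := Q1.ncard_vars_le_varmax i
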